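/- Under the stated hypotheses, the Orbit 1 (K,L,L) three-term relation holds: S(f−e)·A(1−a, e−a, f−a, g−a)·K(a;b,c,d;e,f,g) + S(f−a)·A(e−a, e−b, e−c, e−d)·L(a,b,c,d;e;f,g) − S(e−a)·A(f−a, f−b, f−c, f−d)·L(a,b,c,d;f;e,g) = 0. -/

import Mathlib

noncomputable section

open Complex

/-- `Sn x = sin (π x)`. -/
def Sn (x : ℂ) : ℂ := Complex.sin ((Real.pi : ℂ) * x)

/-- The renormalized Saalschützian series
`F*(a,b,c,d;e,f,g) = ∑ₖ Γ(k+a)Γ(k+b)Γ(k+c)Γ(k+d)/(k!·Γ(k+e)Γ(k+f)Γ(k+g))`. -/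
def Fstar (a b c d e f g : ℂ) : ℂ :=
  ∑' k : ℕ, (Complex.Gamma (k + a) * Complex.Gamma (k + b) *
      Complex.Gamma (k + c) * Complex.Gamma (k + d)) /
    ((k.factorial : ℂ) * Complex.Gamma (k + e) * Complex.Gamma (k + f) *
      Complex.Gamma (k + g))

/-- The function `K(a;b,c,d;e,f,g)`. -/
def Kf (a b c d e f g : ℂ) : ℂ :=
  (Fstar a b c d e f g +
      Fstar a (1 + a - e) (1 + a - f) (1 + a - g) (1 + a - b) (1 + a - c) (1 + a - d)) /
    (Sn a * Complex.Gamma a ^ 2 * Complex.Gamma b * Complex.Gamma c * Complex.Gamma d *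
      Complex.Gamma (1 + a - e) * Complex.Gamma (1 + a - f) * Complex.Gamma (1 + a - g))

/-- The function `L(a,b,c,d;e;f,g)`. -/
def Lf (a b c d e f g : ℂ) : ℂ :=
  (Fstar a b c d e f g -
      Fstar (1 + a - e) (1 + b - e) (1 + c - e) (1 + d - e) (2 - e) (1 + f - e) (1 + g - e)) /
    (Sn e * Complex.Gamma a * Complex.Gamma b * Complex.Gamma c * Complex.Gamma d *
      Complex.Gamma (1 + a - e) * Complex.Gamma (1 + b - e) * Complex.Gamma (1 + c - e) *
      Complex.Gamma (1 + d - e))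

/-- `A(x,y,z,t) = 1/(Γ(x)Γ(y)Γ(z)Γ(t))`. -/
def Af (x y z t : ℂ) : ℂ :=
  1 / (Complex.Gamma x * Complex.Gamma y * Complex.Gamma z * Complex.Gamma t)

def B1 (a b c d e f g : ℂ) : ℂ :=
  Sn b * Sn c * (Sn (b - a) * Sn (c - a) * Sn d + Sn (e - a) * Sn (f - a) * Sn (g - a)) /
    (Real.pi : ℂ) ^ 4

def B2 (a b c d e f g : ℂ) : ℂ :=
  Sn (f - a) * Sn (g - a) *
    (Sn (b - a) * Sn (c - a) * Sn (d - a) + Sn (e - 2 * a) * Sn (f - a) * Sn (g - a)) /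
    (Real.pi : ℂ) ^ 4

def B3 (a b c d e f g : ℂ) : ℂ :=
  (Sn f * Sn (f - e) * Sn (g - a) * Sn (g - b) * Sn (g - c) * Sn (g - d) -
      Sn g * Sn (g - e) * Sn (f - a) * Sn (f - b) * Sn (f - c) * Sn (f - d)) /
    ((Real.pi : ℂ) ^ 4 * Sn (f - g))

def B4 (a b c d e f g : ℂ) : ℂ :=
  Sn (f - a) * Sn (g - a) * (Sn b * Sn c * Sn d + Sn (e - a) * Sn f * Sn g) /
    (Real.pi : ℂ) ^ 4

def B5 (a b c d e f g : ℂ) : ℂ :=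
  Sn b * Sn (e - b) *
    (Sn (b - a) * Sn (c - a) * Sn (d - a) + Sn (e - 2 * a) * Sn (f - a) * Sn (g - a)) /
    (Real.pi : ℂ) ^ 4

def Cf (a b c d e f g : ℂ) : ℂ :=
  Sn (e - a) * (Sn b * Sn c * Sn d * B2 a b c d e f g +
      Sn e * Sn (f - a) * Sn (g - a) * B4 a b c d e f g) / (Real.pi : ℂ) ^ 4

open Filter Topology in
/-- `Q m` is asymptotic to `m ^ δ` as `m → ∞`. -/
def GrowsLike (Q : ℕ → ℂ) (δ : ℂ) : Prop :=
  Tendsto (fun m : ℕ => Q m / (m : ℂ) ^ δ) atTop (𝓝 1)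

/-- `z` is not an integer. -/
def NotInt (z : ℂ) : Prop := ∀ n : ℤ, z ≠ n

/-- The ratio `Γ(α + m) / Γ(m)`. -/
def gammaRatio (α : ℂ) (m : ℕ) : ℂ := Gamma (α + m) / Gamma m

section Growth

open Filter Topology

lemma NotInt.add_int {u w : ℂ} (h : NotInt u) (n : ℤ) (hw : w = u + n) : NotInt w := by
  intro m hm
  apply h (m - n)
  push_cast
  linear_combination hm - hw

lemma NotInt.neg_add_int {u w : ℂ} (h : NotInt u) (n : ℤ) (hw : w = -u + n) : NotInt w := by
  intro m hm
  apply h (n - m)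
  push_cast
  linear_combination hw - hm

lemma NotInt.gamma_ne_zero {z : ℂ} (h : NotInt z) : Gamma z ≠ 0 :=
  Gamma_ne_zero fun m hm => h (-m) (by push_cast; exact hm)

lemma NotInt.gamma_add_nat_ne_zero {z : ℂ} (h : NotInt z) (k : ℕ) : Gamma (z + k) ≠ 0 :=
  (h.add_int k (by push_cast; rfl)).gamma_ne_zero

lemma gamma_natCast_ne_zero {m : ℕ} (hm : m ≠ 0) : Gamma (m : ℂ) ≠ 0 :=
  Gamma_ne_zero_of_re_pos (by simpa using Nat.pos_of_ne_zero hm)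

lemma NotInt.Sn_ne_zero {z : ℂ} (h : NotInt z) : Sn z ≠ 0 := by
  intro h0
  obtain ⟨k, hk⟩ := Complex.sin_eq_zero_iff.1 h0
  apply h k
  have : (Real.pi : ℂ) ≠ 0 := by exact_mod_cast Real.pi_ne_zero
  apply mul_left_cancel₀ this
  rw [hk, mul_comm]

lemma prod_range_add_eq_gamma {z : ℂ} (h : NotInt z) (n : ℕ) :
    ∏ j ∈ Finset.range n, (z + j) = Gamma (z + n) / Gamma z := by
  induction n with
  | zero => simp [h.gamma_ne_zero]
  | succ n ih =>
    have hz : z + n ≠ 0 := fun h0 => h (-n) (by push_cast; linear_combination h0)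
    rw [Finset.prod_range_succ, ih]
    push_cast
    rw [← add_assoc, Gamma_add_one _ hz]
    ring

lemma GrowsLike.mul {Q R : ℕ → ℂ} {δ ε : ℂ} (hQ : GrowsLike Q δ) (hR : GrowsLike R ε) :
    GrowsLike (fun m => Q m * R m) (δ + ε) := by
  have h := Tendsto.mul hQ hR
  rw [mul_one] at h
  refine h.congr' ?_
  filter_upwards [eventually_ne_atTop 0] with m hm
  rw [cpow_add _ _ (Nat.cast_ne_zero.2 hm), mul_div_mul_comm]

lemma GrowsLike.div {Q R : ℕ → ℂ} {δ ε : ℂ} (hQ : GrowsLike Q δ) (hR : GrowsLike R ε) :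
    GrowsLike (fun m => Q m / R m) (δ - ε) := by
  have h := Tendsto.div hQ hR one_ne_zero
  rw [div_one] at h
  refine h.congr' ?_
  filter_upwards [eventually_ne_atTop 0] with m hm
  simp only [Pi.div_apply]
  rw [cpow_sub _ _ (Nat.cast_ne_zero.2 hm), div_div_div_comm]

lemma GrowsLike.congr {Q R : ℕ → ℂ} {δ ε : ℂ} (hQ : GrowsLike Q δ)
    (h : ∀ m ≠ 0, Q m = R m) (hδ : δ = ε) : GrowsLike R ε := by
  subst hδ
  refine Tendsto.congr' ?_ hQ
  filter_upwards [eventually_ne_atTop 0] with m hm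
  rw [h m hm]

lemma growsLike_natCast : GrowsLike (fun m => (m : ℂ)) 1 := by
  refine Tendsto.congr' ?_ tendsto_const_nhds
  filter_upwards [eventually_ne_atTop 0] with m hm
  rw [cpow_one, div_self (Nat.cast_ne_zero.2 hm)]

lemma tendsto_natCast_add_div (z : ℂ) :
    Tendsto (fun n : ℕ => (z + n) / (n : ℂ)) atTop (𝓝 1) := by
  have h : Tendsto (fun n : ℕ => z / (n : ℂ) + 1) atTop (𝓝 (0 + 1)) :=
    (tendsto_const_div_atTop_nhds_zero_nat z).add tendsto_const_nhds
  rw [zero_add] at h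
  refine h.congr' ?_
  filter_upwards [eventually_ne_atTop 0] with m hm
  have : (m : ℂ) ≠ 0 := Nat.cast_ne_zero.2 hm
  field_simp

lemma growsLike_gammaRatio {α : ℂ} (h : NotInt α) : GrowsLike (gammaRatio α) α := by
  have h1 := (GammaSeq_tendsto_Gamma α).div_const (Gamma α)
  rw [div_self h.gamma_ne_zero] at h1
  have h2 := ((tendsto_natCast_add_div α).mul h1).inv₀ (by simp)
  rw [mul_one, inv_one] at h2
  refine h2.congr' ?_
  filter_upwards [eventually_ne_atTop 0] with m hm
  have hm' : (m : ℂ) ≠ 0 := Nat.cast_ne_zero.2 hm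
  have hz : α + m ≠ 0 := fun h0 => h (-m) (by push_cast; linear_combination h0)
  have hpow : (m : ℂ) ^ α ≠ 0 := by simp [cpow_eq_zero_iff, hm']
  have hg : (Nat.factorial m : ℂ) = m * Gamma m := by
    rw [← Gamma_nat_eq_factorial, Gamma_add_one _ hm']
  have := h.gamma_ne_zero
  have := h.gamma_add_nat_ne_zero m
  have := gamma_natCast_ne_zero hm
  rw [GammaSeq, prod_range_add_eq_gamma h, gammaRatio, hg]
  push_cast
  rw [← add_assoc, Gamma_add_one _ hz]
  field_simp

lemma GrowsLike.exists_bound {Q : ℕ → ℂ} {δ : ℂ} (hQ : GrowsLike Q δ) :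
    ∃ C : ℝ, 0 ≤ C ∧ ∀ m : ℕ, m ≠ 0 → ‖Q m‖ ≤ C * (m : ℝ) ^ δ.re := by
  obtain ⟨C, hC⟩ := (Metric.isBounded_range_of_tendsto _ hQ).exists_norm_le
  refine ⟨C, (norm_nonneg _).trans (hC _ ⟨0, rfl⟩), fun m hm => ?_⟩
  have h := hC _ ⟨m, rfl⟩
  have hpos : (0 : ℝ) < (m : ℝ) ^ δ.re :=
    Real.rpow_pos_of_pos (by exact_mod_cast Nat.pos_of_ne_zero hm) _
  rwa [norm_div, norm_natCast_cpow_of_pos (Nat.pos_of_ne_zero hm), div_le_iff₀ hpos] at h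

lemma GrowsLike.summable_norm {T : ℕ → ℂ} (hT : GrowsLike T (-2)) :
    Summable fun k => ‖T k‖ := by
  obtain ⟨C, -, hC⟩ := hT.exists_bound
  have hs : Summable fun m : ℕ => C * (m : ℝ) ^ (-2 : ℝ) :=
    (Real.summable_nat_rpow.2 (by norm_num)).mul_left C
  refine (summable_nat_add_iff 1).1 (Summable.of_nonneg_of_le (fun _ => norm_nonneg _)
    (fun k => ?_) ((summable_nat_add_iff 1).2 hs))
  simpa using hC (k + 1) (by simp)

lemma tendsto_natCast_add_cpow_div (δ : ℂ) (k : ℕ) :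
    Tendsto (fun n : ℕ => ((n + k : ℕ) : ℂ) ^ δ / (n : ℂ) ^ δ) atTop (𝓝 1) := by
  have h1 : ContinuousAt (fun z : ℂ => z ^ δ) 1 :=
    continuousAt_cpow_const (by simp)
  have h2 := h1.tendsto.comp (tendsto_natCast_add_div (k : ℂ))
  rw [one_cpow] at h2
  refine h2.congr' ?_
  filter_upwards [eventually_ne_atTop 0] with m hm
  have hm' : (m : ℂ) ≠ 0 := Nat.cast_ne_zero.2 hm
  have hpow : (m : ℂ) ^ δ ≠ 0 := by simp [cpow_eq_zero_iff, hm']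
  rw [eq_div_iff hpow]
  have h3 := mul_cpow_ofReal_nonneg (a := ((k : ℝ) + m) / m) (b := m) (by positivity)
    (by positivity) δ
  push_cast at h3
  simp only [Function.comp_apply]
  rw [← h3, div_mul_cancel₀ _ hm']
  push_cast
  rw [add_comm]

lemma GrowsLike.tendsto_mul_sub {P Q : ℕ → ℂ} {δ ε : ℂ} (hP : GrowsLike P δ)
    (hQ : GrowsLike Q ε) (hδε : δ + ε = 1) (k : ℕ) :
    Tendsto (fun n : ℕ => P (n + k) * Q (n - k) / n) atTop (𝓝 1) := by
  rw [← tendsto_add_atTop_iff_nat k]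
  have h1 : Tendsto (fun n : ℕ => P (n + 2 * k) / ((n + 2 * k : ℕ) : ℂ) ^ δ) atTop (𝓝 1) :=
    (tendsto_add_atTop_iff_nat (2 * k)).2 hP
  have h2 := tendsto_natCast_add_cpow_div δ (2 * k)
  have h3 := (tendsto_natCast_add_div (k : ℂ)).inv₀ one_ne_zero
  have h4 := ((h1.mul h2).mul hQ).mul h3
  simp only [mul_one, inv_one] at h4
  refine h4.congr' ?_
  filter_upwards [eventually_ne_atTop 0] with n hn
  have hn' : (n : ℂ) ≠ 0 := Nat.cast_ne_zero.2 hn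
  have hδ : (n : ℂ) ^ δ ≠ 0 := by simp [cpow_eq_zero_iff, hn']
  have hε : (n : ℂ) ^ ε ≠ 0 := by simp [cpow_eq_zero_iff, hn']
  have hk : ((n + 2 * k : ℕ) : ℂ) ≠ 0 := Nat.cast_ne_zero.2 (by omega)
  have hδ2 : ((n + 2 * k : ℕ) : ℂ) ^ δ ≠ 0 :=
    fun h0 => hk ((cpow_eq_zero_iff _ _).1 h0).1
  have hkn : (k : ℂ) + n ≠ 0 := by exact_mod_cast (by omega : k + n ≠ 0)
  have hprod : (n : ℂ) ^ δ * (n : ℂ) ^ ε = n := by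
    rw [← cpow_add _ _ hn', hδε, cpow_one]
  have e1 : n + k + k = n + 2 * k := by ring
  rw [e1, Nat.add_sub_cancel, Nat.cast_add n k, add_comm (n : ℂ) k]
  generalize ((n + 2 * k : ℕ) : ℂ) ^ δ = u at *
  calc _ = P (n + 2 * k) * Q n * n / (((n : ℂ) ^ δ * (n : ℂ) ^ ε) * (k + n)) := by field_simp
    _ = _ := by rw [hprod]; field_simp

lemma GrowsLike.tendsto_sum {P Q T : ℕ → ℂ} {δ ε : ℂ} (hP : GrowsLike P δ)
    (hQ : GrowsLike Q ε) (hT : GrowsLike T (-2)) (hδε : δ + ε = 1) (hδ : 0 ≤ δ.re)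
    (hε : 0 ≤ ε.re) :
    Tendsto (fun n : ℕ => (∑ k ∈ Finset.range n, T k * (P (n + k) * Q (n - k))) / n) atTop
      (𝓝 (∑' k, T k)) := by
  obtain ⟨C, hC0, hC⟩ := hP.exists_bound
  obtain ⟨D, hD0, hD⟩ := hQ.exists_bound
  have hre : δ.re + ε.re = 1 := by simpa using congrArg re hδε
  have key : Tendsto (fun n : ℕ => ∑' k, if k < n then T k * (P (n + k) * Q (n - k) / n) else 0)
      atTop (𝓝 (∑' k, T k)) := by
    refine tendsto_tsum_of_dominated_convergence (bound := fun k => ‖T k‖ * (2 * C * D))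
      (hT.summable_norm.mul_right _) (fun k => ?_) (Eventually.of_forall fun n k => ?_)
    · have h := (hP.tendsto_mul_sub hQ hδε k).const_mul (T k)
      rw [mul_one] at h
      refine h.congr' ?_
      filter_upwards [eventually_gt_atTop k] with n hn
      rw [if_pos hn]
    · split_ifs with hk
      · rw [norm_mul]
        refine mul_le_mul_of_nonneg_left ?_ (norm_nonneg _)
        have hn0 : (0 : ℝ) < n := by exact_mod_cast (by omega : 0 < n)
        rw [norm_div, norm_mul, norm_natCast, div_le_iff₀ hn0]
        have b1 : ((n + k : ℕ) : ℝ) ^ δ.re ≤ 2 * (n : ℝ) ^ δ.re := by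
          calc ((n + k : ℕ) : ℝ) ^ δ.re ≤ (2 * (n : ℝ)) ^ δ.re := by
                refine Real.rpow_le_rpow (by positivity) ?_ hδ
                exact_mod_cast (by omega : n + k ≤ 2 * n)
            _ = 2 ^ δ.re * (n : ℝ) ^ δ.re := Real.mul_rpow (by norm_num) hn0.le
            _ ≤ 2 ^ (1 : ℝ) * (n : ℝ) ^ δ.re := by
                gcongr
                · norm_num
                · linarith
            _ = _ := by rw [Real.rpow_one]
        have b2 : ((n - k : ℕ) : ℝ) ^ ε.re ≤ (n : ℝ) ^ ε.re := by
          refine Real.rpow_le_rpow (by positivity) ?_ hε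
          exact_mod_cast Nat.sub_le n k
        calc ‖P (n + k)‖ * ‖Q (n - k)‖
            ≤ (C * (2 * (n : ℝ) ^ δ.re)) * (D * (n : ℝ) ^ ε.re) := by
              refine mul_le_mul ((hC _ (by omega)).trans ?_) ((hD _ (by omega)).trans ?_)
                (norm_nonneg _) (by positivity)
              · exact mul_le_mul_of_nonneg_left b1 hC0
              · exact mul_le_mul_of_nonneg_left b2 hD0
          _ = 2 * C * D * ((n : ℝ) ^ δ.re * (n : ℝ) ^ ε.re) := by ring
          _ = 2 * C * D * n := by rw [← Real.rpow_add hn0, hre, Real.rpow_one]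
      · rw [norm_zero]
        positivity
  refine key.congr fun n => ?_
  rw [tsum_eq_sum (s := Finset.range n) (fun k hk => if_neg (by simpa using hk)),
    Finset.sum_div]
  refine Finset.sum_congr rfl fun k hk => ?_
  rw [if_pos (by simpa using hk)]
  ring

end Growth
/-- The general term of the series `Fstar`. -/
def FstarTerm (a b c d e f g : ℂ) (k : ℕ) : ℂ :=
  (Gamma (k + a) * Gamma (k + b) * Gamma (k + c) * Gamma (k + d)) /
    ((k.factorial : ℂ) * Gamma (k + e) * Gamma (k + f) * Gamma (k + g))

lemma Fstar_eq_tsum (a b c d e f g : ℂ) :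
    Fstar a b c d e f g = ∑' k, FstarTerm a b c d e f g k := rfl

lemma growsLike_FstarTerm {a b c d e f g : ℂ} (hsaal : e + f + g = a + b + c + d + 1)
    (ha : NotInt a) (hb : NotInt b) (hc : NotInt c) (hd : NotInt d) (he : NotInt e)
    (hf : NotInt f) (hg : NotInt g) : GrowsLike (FstarTerm a b c d e f g) (-2) := by
  refine GrowsLike.congr
    (((((growsLike_gammaRatio ha).mul (growsLike_gammaRatio hb)).mul
      (growsLike_gammaRatio hc)).mul (growsLike_gammaRatio hd)).div
      (((growsLike_natCast.mul (growsLike_gammaRatio he)).mul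
        (growsLike_gammaRatio hf)).mul (growsLike_gammaRatio hg)))
    (fun m hm => ?_) (by linear_combination -hsaal)
  have hfac : (Nat.factorial m : ℂ) = m * Gamma m := by
    rw [← Gamma_nat_eq_factorial, Gamma_add_one _ (Nat.cast_ne_zero.2 hm)]
  have := gamma_natCast_ne_zero hm
  have hm' : (m : ℂ) ≠ 0 := Nat.cast_ne_zero.2 hm
  have := he.gamma_add_nat_ne_zero m
  have := hf.gamma_add_nat_ne_zero m
  have := hg.gamma_add_nat_ne_zero m
  simp only [gammaRatio, FstarTerm, hfac, add_comm (m : ℂ)]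
  field_simp

lemma one_div_gamma_sub_nat {z : ℂ} (h : NotInt z) (k : ℕ) :
    1 / Gamma (z - k) = (-1) ^ k * (Gamma (k + (1 - z)) * Sn z / (Real.pi : ℂ)) := by
  have h1 : NotInt (z - k) := h.add_int (-k) (by push_cast; ring)
  have h2 := Gamma_mul_Gamma_one_sub (z - k)
  have h3 : Complex.sin ((Real.pi : ℂ) * (z - k)) = (-1) ^ k * Sn z := by
    rw [Sn, mul_sub, mul_comm (Real.pi : ℂ) (k : ℂ)]
    exact Complex.sin_antiperiodic.sub_nat_mul_eq k
  have h4 : (1 : ℂ) - (z - k) = k + (1 - z) := by ring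
  have hS := h.Sn_ne_zero
  have hG := h1.gamma_ne_zero
  have hpi : (Real.pi : ℂ) ≠ 0 := by exact_mod_cast Real.pi_ne_zero
  have hs : ((-1 : ℂ) ^ k) * (-1) ^ k = 1 := by rw [← mul_pow]; simp
  have hs0 : ((-1 : ℂ) ^ k) ≠ 0 := by simp
  rw [h3, h4] at h2
  rw [div_eq_iff hG]
  rw [eq_div_iff (mul_ne_zero hs0 hS)] at h2
  field_simp
  linear_combination -h2

lemma prod_range_sub_nat {z δ : ℂ} (h : NotInt z) {N n k : ℕ} (hN : (N : ℂ) = n + δ)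
    (hk : k ≤ n) :
    ∏ j ∈ Finset.range N, (z - k + j) = (-1) ^ k * (Gamma (k + (1 - z)) * Sn z / (Real.pi : ℂ)) *
      Gamma (z + δ + (n - k : ℕ)) := by
  have h1 : NotInt (z - k) := h.add_int (-k) (by push_cast; ring)
  rw [prod_range_add_eq_gamma h1, ← one_div_gamma_sub_nat h, hN, Nat.cast_sub hk,
    one_div, div_eq_inv_mul]
  congr 2
  ring

lemma prod_range_add_nat {z δ : ℂ} (h : NotInt z) {N n : ℕ} (hN : (N : ℂ) = n + δ) (k : ℕ) :
    ∏ j ∈ Finset.range N, (z + k + j) = Gamma (z + δ + (n + k : ℕ)) / Gamma (k + z) := by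
  have h1 : NotInt (z + k) := h.add_int k (by push_cast; ring)
  rw [prod_range_add_eq_gamma h1, hN, add_comm z k]
  congr 2
  push_cast
  ring

lemma prod_range_natCast_sub (k : ℕ) :
    ∏ j ∈ Finset.range k, ((k : ℂ) - j) = k.factorial := by
  induction k with
  | zero => simp
  | succ k ih =>
    rw [Finset.prod_range_succ', Nat.factorial_succ]
    simp only [Nat.cast_add, Nat.cast_one, add_sub_add_right_eq_sub, ih]
    push_cast
    ring

lemma prod_erase_natCast_sub {n k : ℕ} (hk : k < n) :
    ∏ j ∈ (Finset.range n).erase k, ((k : ℂ) - j) =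
      (-1) ^ (n + k + 1) * ((k.factorial : ℂ) * Gamma (n - k : ℕ)) := by
  obtain ⟨m, rfl⟩ : ∃ m, n = k + 1 + m := ⟨n - (k + 1), by omega⟩
  have hset : (Finset.range (k + 1 + m)).erase k =
      Finset.range k ∪ Finset.Ico (k + 1) (k + 1 + m) := by
    ext j
    simp only [Finset.mem_erase, Finset.mem_range, Finset.mem_union, Finset.mem_Ico]
    omega
  have hdisj : Disjoint (Finset.range k) (Finset.Ico (k + 1) (k + 1 + m)) := by
    rw [Finset.disjoint_left]
    intro j
    simp only [Finset.mem_range, Finset.mem_Ico]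
    omega
  have h1 : ∀ i : ℕ, (k : ℂ) - ((k + 1 + i : ℕ) : ℂ) = -1 * ((i + 1 : ℕ) : ℂ) := by
    intro i
    push_cast
    ring
  have h2 : k + 1 + m - k = m + 1 := by omega
  have h3 : (-1 : ℂ) ^ (k + 1 + m + k + 1) = (-1) ^ m := by
    rw [show k + 1 + m + k + 1 = 2 * (k + 1) + m by ring, pow_add, pow_mul]
    simp
  rw [hset, Finset.prod_union hdisj, prod_range_natCast_sub, Finset.prod_Ico_eq_prod_range,
    Nat.add_sub_cancel_left, h2, h3]
  simp only [h1]
  rw [Finset.prod_mul_distrib, Finset.prod_const, Finset.card_range, ← Nat.cast_prod,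
    Finset.prod_range_add_one_eq_factorial]
  push_cast
  rw [Gamma_nat_eq_factorial]
  ring

set_option maxHeartbeats 1000000 in
lemma right_residue {A G β₁ β₂ β₃ η₁ η₂ δ₁ δ₂ : ℂ} (hA : NotInt A) (hG : NotInt G)
    (hβ₁ : NotInt β₁) (hβ₂ : NotInt β₂) (hβ₃ : NotInt β₃) (hη₁ : NotInt η₁) (hη₂ : NotInt η₂)
    {N₁ N₂ n k : ℕ} (hN₁ : (N₁ : ℂ) = n + δ₁) (hN₂ : (N₂ : ℂ) = n + δ₂) (hk : k < n) :
    (∏ j ∈ Finset.range N₁, (G + k + j)) *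
      ((-1) ^ N₂ * ∏ j ∈ Finset.range N₂, (β₁ - k + j)) *
      ((-1) ^ n * ∏ j ∈ Finset.range n, (β₂ - k + j)) *
      ((-1) ^ n * ∏ j ∈ Finset.range n, (β₃ - k + j)) /
      ((∏ j ∈ (Finset.range n).erase k, ((k : ℂ) - j)) *
      ((∏ j ∈ Finset.range n, (A + k + j)) *
      ((-1) ^ n * ∏ j ∈ Finset.range n, (η₁ - k + j)) *
      ((-1) ^ n * ∏ j ∈ Finset.range n, (η₂ - k + j)))) =
    -(-1) ^ (N₂ + n) * (Sn β₁ * Sn β₂ * Sn β₃ / ((Real.pi : ℂ) * Sn η₁ * Sn η₂)) *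
      (FstarTerm A (1 - β₁) (1 - β₂) (1 - β₃) (1 - η₁) (1 - η₂) G k *
        (gammaRatio (G + δ₁) (n + k) / gammaRatio A (n + k) *
          (gammaRatio (β₁ + δ₂) (n - k) * gammaRatio β₂ (n - k) * gammaRatio β₃ (n - k) /
            (gammaRatio η₁ (n - k) * gammaRatio η₂ (n - k))))) := by
  have hn : (n : ℂ) = n + 0 := by ring
  have hnk : n - k ≠ 0 := by omega
  rw [prod_range_add_nat hG hN₁, prod_range_sub_nat hβ₁ hN₂ hk.le,
    prod_range_sub_nat hβ₂ hn hk.le, prod_range_sub_nat hβ₃ hn hk.le,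
    prod_range_sub_nat hη₁ hn hk.le, prod_range_sub_nat hη₂ hn hk.le,
    prod_range_add_nat hA hn, prod_erase_natCast_sub hk]
  have e1 : (-1 : ℂ) ^ (n + k + 1) = -((-1) ^ n * (-1) ^ k) := by ring
  have e2 : (-1 : ℂ) ^ (N₂ + n) = (-1) ^ N₂ * (-1) ^ n := by ring
  have hpi : (Real.pi : ℂ) ≠ 0 := by exact_mod_cast Real.pi_ne_zero
  have hfac : (Nat.factorial k : ℂ) ≠ 0 := by exact_mod_cast Nat.factorial_ne_zero k
  have g1 := gamma_natCast_ne_zero hnk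
  have g2 := gamma_natCast_ne_zero (show n + k ≠ 0 by omega)
  have g3 := hA.gamma_add_nat_ne_zero (n + k)
  have g4 := hη₁.gamma_add_nat_ne_zero (n - k)
  have g5 := hη₂.gamma_add_nat_ne_zero (n - k)
  have g6 := hA.gamma_add_nat_ne_zero k
  have g7 := hG.gamma_add_nat_ne_zero k
  have g8 := (hη₁.neg_add_int (w := 1 - η₁) 1 (by push_cast; ring)).gamma_add_nat_ne_zero k
  have g9 := (hη₂.neg_add_int (w := 1 - η₂) 1 (by push_cast; ring)).gamma_add_nat_ne_zero k
  have s1 := hη₁.Sn_ne_zero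
  have s2 := hη₂.Sn_ne_zero
  rw [e1, e2]
  simp only [gammaRatio, FstarTerm, add_zero]
  rw [add_comm] at g6 g7 g8 g9
  generalize Gamma (β₁ + δ₂ + ((n - k : ℕ) : ℂ)) = t₁ at *
  generalize Gamma (β₂ + ((n - k : ℕ) : ℂ)) = t₂ at *
  generalize Gamma (β₃ + ((n - k : ℕ) : ℂ)) = t₃ at *
  generalize Gamma (η₁ + ((n - k : ℕ) : ℂ)) = t₄ at *
  generalize Gamma (η₂ + ((n - k : ℕ) : ℂ)) = t₅ at *
  generalize Gamma (G + δ₁ + ((n + k : ℕ) : ℂ)) = t₆ at *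
  generalize Gamma (A + ((n + k : ℕ) : ℂ)) = t₇ at *
  generalize Gamma ((n + k : ℕ) : ℂ) = t₈ at *
  generalize Gamma ((n - k : ℕ) : ℂ) = t₉ at *
  generalize Gamma ((k : ℂ) + (1 - β₁)) = r₁ at *
  generalize Gamma ((k : ℂ) + (1 - β₂)) = r₂ at *
  generalize Gamma ((k : ℂ) + (1 - β₃)) = r₃ at *
  generalize Gamma ((k : ℂ) + (1 - η₁)) = r₄ at *
  generalize Gamma ((k : ℂ) + (1 - η₂)) = r₅ at *
  generalize Gamma ((k : ℂ) + G) = r₆ at *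
  generalize Gamma ((k : ℂ) + A) = r₇ at *
  generalize Sn β₁ = s₁ at *
  generalize Sn β₂ = s₂ at *
  generalize Sn β₃ = s₃ at *
  generalize Sn η₁ = s₄ at *
  generalize Sn η₂ = s₅ at *
  generalize (Real.pi : ℂ) = q at *
  generalize (Nat.factorial k : ℂ) = w at *
  generalize (-1 : ℂ) ^ N₂ = y at *
  have k1 : t₆ / t₈ / (t₇ / t₈) = t₆ / t₇ := by field_simp
  have k2 : t₁ / t₉ * (t₂ / t₉) * (t₃ / t₉) / (t₄ / t₉ * (t₅ / t₉)) =
    t₁ * t₂ * t₃ / (t₄ * t₅ * t₉) := by field_simp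
  have k3 (Z : ℂ) : s₁ * s₂ * s₃ / (q * s₄ * s₅) * (r₇ * r₁ * r₂ * r₃ / (w * r₄ * r₅ * r₆) * Z) =
    (r₁ * s₁ / q) * (r₂ * s₂ / q) * (r₃ * s₃ / q) / ((r₄ * s₄ / q) * (r₅ * s₅ / q)) *
      (r₇ / (w * r₆)) * Z := by field_simp
  have k4 : r₄ * s₄ / q ≠ 0 := div_ne_zero (mul_ne_zero g8 s1) hpi
  have k5 : r₅ * s₅ / q ≠ 0 := div_ne_zero (mul_ne_zero g9 s2) hpi
  rw [k1, k2, mul_assoc (-(y * (-1) ^ n)), k3]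
  clear k1 k2 k3
  generalize r₁ * s₁ / q = p₁ at *
  generalize r₂ * s₂ / q = p₂ at *
  generalize r₃ * s₃ / q = p₃ at *
  generalize r₄ * s₄ / q = p₄ at *
  generalize r₅ * s₅ / q = p₅ at *
  rcases neg_one_pow_eq_or ℂ n with hu | hu <;> rcases neg_one_pow_eq_or ℂ k with hv | hv <;>
  · rw [hu, hv]
    field_simp

set_option maxHeartbeats 1000000 in
lemma left_residue {G B₁ B₂ B₃ X₁ X₂ X₃ δ₁ δ₂ : ℂ} (hG : NotInt G)
    (hB₁ : NotInt B₁) (hB₂ : NotInt B₂) (hB₃ : NotInt B₃) (hX₁ : NotInt X₁) (hX₂ : NotInt X₂)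
    (hX₃ : NotInt X₃)
    {N₁ N₂ n k : ℕ} (hN₁ : (N₁ : ℂ) = n + δ₁) (hN₂ : (N₂ : ℂ) = n + δ₂) (hk : k < n) :
    (∏ j ∈ Finset.range N₁, (G - k + j)) *
      ((-1) ^ N₂ * ∏ j ∈ Finset.range N₂, (B₁ + k + j)) *
      ((-1) ^ n * ∏ j ∈ Finset.range n, (B₂ + k + j)) *
      ((-1) ^ n * ∏ j ∈ Finset.range n, (B₃ + k + j)) /
      (((-1) ^ (n - 1) * ∏ j ∈ (Finset.range n).erase k, ((k : ℂ) - j)) *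
      (((-1) ^ n * ∏ j ∈ Finset.range n, (X₁ + k + j)) *
      ((-1) ^ n * ∏ j ∈ Finset.range n, (X₂ + k + j)) *
      ((-1) ^ n * ∏ j ∈ Finset.range n, (X₃ + k + j)))) =
    (-1) ^ (N₂ + n) * (Sn G / (Real.pi : ℂ)) *
      (FstarTerm X₁ X₂ X₃ (1 - G) B₁ B₂ B₃ k *
        ((gammaRatio (B₁ + δ₂) (n + k) * gammaRatio B₂ (n + k) * gammaRatio B₃ (n + k)) /
          (gammaRatio X₁ (n + k) * gammaRatio X₂ (n + k) * gammaRatio X₃ (n + k)) *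
          gammaRatio (G + δ₁) (n - k))) := by
  have hn : (n : ℂ) = n + 0 := by ring
  have hnk : n - k ≠ 0 := by omega
  obtain ⟨m, rfl⟩ : ∃ m, n = m + 1 := ⟨n - 1, by omega⟩
  rw [prod_range_sub_nat hG hN₁ hk.le, prod_range_add_nat hB₁ hN₂,
    prod_range_add_nat hB₂ hn, prod_range_add_nat hB₃ hn, prod_range_add_nat hX₁ hn,
    prod_range_add_nat hX₂ hn, prod_range_add_nat hX₃ hn, prod_erase_natCast_sub hk]
  rw [Nat.add_sub_cancel]
  generalize hnm : m + 1 = n at *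
  have e0 : (-1 : ℂ) ^ n = -(-1) ^ m := by rw [← hnm]; ring
  have e1 : (-1 : ℂ) ^ (n + k + 1) = -((-1) ^ n * (-1) ^ k) := by ring
  have e2 : (-1 : ℂ) ^ (N₂ + n) = (-1) ^ N₂ * (-1) ^ n := by ring
  have hpi : (Real.pi : ℂ) ≠ 0 := by exact_mod_cast Real.pi_ne_zero
  have hfac : (Nat.factorial k : ℂ) ≠ 0 := by exact_mod_cast Nat.factorial_ne_zero k
  have g1 := gamma_natCast_ne_zero hnk
  have g2 := gamma_natCast_ne_zero (show n + k ≠ 0 by omega)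
  have g3 := hX₁.gamma_add_nat_ne_zero (n + k)
  have g4 := hX₂.gamma_add_nat_ne_zero (n + k)
  have g5 := hX₃.gamma_add_nat_ne_zero (n + k)
  have g6 := hB₁.gamma_add_nat_ne_zero k
  have g7 := hB₂.gamma_add_nat_ne_zero k
  have g8 := hB₃.gamma_add_nat_ne_zero k
  have g9 := hX₁.gamma_add_nat_ne_zero k
  have g10 := hX₂.gamma_add_nat_ne_zero k
  have g11 := hX₃.gamma_add_nat_ne_zero k
  rw [e1, e2, e0]
  simp only [gammaRatio, FstarTerm, add_zero]
  rw [add_comm] at g6 g7 g8 g9 g10 g11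
  rcases neg_one_pow_eq_or ℂ m with hu | hu <;> rcases neg_one_pow_eq_or ℂ k with hv | hv <;>
  · rw [hu, hv]
    field_simp
open Polynomial in
lemma sum_div_prod_sub_eq_one {n : ℕ} (w : Fin 4 → ℕ → ℂ)
    (hw : ∀ i j k l, w i k = w j l → i = j ∧ k = l) {P : Polynomial ℂ} (hP : P.Monic)
    (hdeg : P.natDegree + 1 = 4 * n) :
    ∑ i, ∑ k ∈ Finset.range n, P.eval (w i k) /
      ((∏ j ∈ (Finset.range n).erase k, (w i k - w i j)) *
        ∏ i' ∈ Finset.univ.erase i, ∏ j ∈ Finset.range n, (w i k - w i' j)) = 1 := by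
  have h := Lagrange.leadingCoeff_eq_sum (s := Finset.univ ×ˢ Finset.range n)
    (v := fun p : Fin 4 × ℕ => w p.1 p.2) (P := P) ?_ ?_
  · rw [hP.leadingCoeff, Finset.sum_product] at h
    rw [h]
    refine Finset.sum_congr rfl fun i _ => Finset.sum_congr rfl fun k hk => ?_
    congr 1
    have hset : (Finset.univ ×ˢ Finset.range n).erase (i, k) =
        ({i} ×ˢ (Finset.range n).erase k) ∪ (Finset.univ.erase i ×ˢ Finset.range n) := by
      ext ⟨i', j⟩
      simp only [Finset.mem_erase, Finset.mem_product, Finset.mem_univ, Finset.mem_range,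
        Finset.mem_union, Finset.mem_singleton, ne_eq, Prod.mk.injEq, true_and, and_true]
      tauto
    have hdisj : Disjoint ({i} ×ˢ (Finset.range n).erase k)
        ((Finset.univ.erase i) ×ˢ Finset.range n) := by
      rw [Finset.disjoint_left]
      rintro ⟨i', j⟩
      simp only [Finset.mem_erase, Finset.mem_product, Finset.mem_singleton]
      tauto
    rw [hset, Finset.prod_union hdisj, Finset.prod_product, Finset.prod_product,
      Finset.prod_singleton]
  · rintro ⟨i, k⟩ _ ⟨j, l⟩ _ hij
    obtain ⟨rfl, rfl⟩ := hw i j k l hij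
    rfl
  · rw [degree_eq_natDegree hP.ne_zero, Finset.card_product, Finset.card_univ, Fintype.card_fin,
      Finset.card_range, ← hdeg]
    rfl

lemma prod_range_eq_neg_one_pow_mul {u v : ℕ → ℂ} (N : ℕ) (h : ∀ j, u j = -v j) :
    ∏ j ∈ Finset.range N, u j = (-1) ^ N * ∏ j ∈ Finset.range N, v j := by
  simp only [h]
  rw [Finset.prod_neg, Finset.card_range]

/-- The sum of the residues at the poles of one right-hand family, up to a constant factor. -/
def rightSum (A G β₁ β₂ β₃ η₁ η₂ δ₁ δ₂ : ℂ) (n : ℕ) : ℂ :=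
  ∑ k ∈ Finset.range n, FstarTerm A (1 - β₁) (1 - β₂) (1 - β₃) (1 - η₁) (1 - η₂) G k *
    (gammaRatio (G + δ₁) (n + k) / gammaRatio A (n + k) *
      (gammaRatio (β₁ + δ₂) (n - k) * gammaRatio β₂ (n - k) * gammaRatio β₃ (n - k) /
        (gammaRatio η₁ (n - k) * gammaRatio η₂ (n - k))))

/-- The sum of the residues at the poles of the left-hand family, up to a constant factor. -/
def leftSum (G B₁ B₂ B₃ X₁ X₂ X₃ δ₁ δ₂ : ℂ) (n : ℕ) : ℂ :=
  ∑ k ∈ Finset.range n, FstarTerm X₁ X₂ X₃ (1 - G) B₁ B₂ B₃ k *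
    ((gammaRatio (B₁ + δ₂) (n + k) * gammaRatio B₂ (n + k) * gammaRatio B₃ (n + k)) /
      (gammaRatio X₁ (n + k) * gammaRatio X₂ (n + k) * gammaRatio X₃ (n + k)) *
      gammaRatio (G + δ₁) (n - k))

section Limits

open Filter Topology

lemma tendsto_rightSum {A G β₁ β₂ β₃ η₁ η₂ δ₁ δ₂ : ℂ} (hA : NotInt A) (hG : NotInt G)
    (hβ₁ : NotInt β₁) (hβ₂ : NotInt β₂) (hβ₃ : NotInt β₃) (hη₁ : NotInt η₁) (hη₂ : NotInt η₂)
    (hδ₁ : NotInt (G + δ₁)) (hδ₂ : NotInt (β₁ + δ₂)) (hδ : δ₁ + δ₂ = -1)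
    (hs : G + β₁ + β₂ + β₃ = A + η₁ + η₂ + 2)
    (h0 : 0 ≤ (G + δ₁ - A).re) (h1 : (G + δ₁ - A).re ≤ 1) :
    Tendsto (fun n : ℕ => rightSum A G β₁ β₂ β₃ η₁ η₂ δ₁ δ₂ n / n) atTop
      (𝓝 (Fstar A (1 - β₁) (1 - β₂) (1 - β₃) (1 - η₁) (1 - η₂) G)) := by
  have hsub {z : ℂ} (hz : NotInt z) : NotInt (1 - z) := hz.neg_add_int 1 (by push_cast; ring)
  have hε : β₁ + δ₂ + β₂ + β₃ - (η₁ + η₂) = 1 - (G + δ₁ - A) := by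
    linear_combination hs + hδ
  have hP := (growsLike_gammaRatio hδ₁).div (growsLike_gammaRatio hA)
  have hQ := (((growsLike_gammaRatio hδ₂).mul (growsLike_gammaRatio hβ₂)).mul
    (growsLike_gammaRatio hβ₃)).div
    ((growsLike_gammaRatio hη₁).mul (growsLike_gammaRatio hη₂))
  have hT := growsLike_FstarTerm (by linear_combination hs) hA (hsub hβ₁) (hsub hβ₂) (hsub hβ₃)
    (hsub hη₁) (hsub hη₂) hG
  rw [hε] at hQ
  have hlim := GrowsLike.tendsto_sum hP hQ hT (by ring) h0 (by rw [sub_re, one_re]; linarith)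
  simp only [rightSum, Fstar_eq_tsum]
  exact hlim

lemma tendsto_leftSum {G B₁ B₂ B₃ X₁ X₂ X₃ δ₁ δ₂ : ℂ} (hG : NotInt G)
    (hB₁ : NotInt B₁) (hB₂ : NotInt B₂) (hB₃ : NotInt B₃) (hX₁ : NotInt X₁) (hX₂ : NotInt X₂)
    (hX₃ : NotInt X₃) (hδ₁ : NotInt (G + δ₁)) (hδ₂ : NotInt (B₁ + δ₂)) (hδ : δ₁ + δ₂ = -1)
    (hs : G + B₁ + B₂ + B₃ = X₁ + X₂ + X₃ + 2)
    (h0 : 0 ≤ (G + δ₁).re) (h1 : (G + δ₁).re ≤ 1) :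
    Tendsto (fun n : ℕ => leftSum G B₁ B₂ B₃ X₁ X₂ X₃ δ₁ δ₂ n / n) atTop
      (𝓝 (Fstar X₁ X₂ X₃ (1 - G) B₁ B₂ B₃)) := by
  have hε : B₁ + δ₂ + B₂ + B₃ - (X₁ + X₂ + X₃) = 1 - (G + δ₁) := by
    linear_combination hs + hδ
  have hP := (((growsLike_gammaRatio hδ₂).mul (growsLike_gammaRatio hB₂)).mul
    (growsLike_gammaRatio hB₃)).div
    (((growsLike_gammaRatio hX₁).mul (growsLike_gammaRatio hX₂)).mul
      (growsLike_gammaRatio hX₃))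
  have hT := growsLike_FstarTerm (by linear_combination hs) hX₁ hX₂ hX₃
    (hG.neg_add_int (w := 1 - G) 1 (by push_cast; ring)) hB₁ hB₂ hB₃
  rw [hε] at hP
  have hlim := GrowsLike.tendsto_sum hP (growsLike_gammaRatio hδ₁) hT (by ring)
    (by rw [sub_re, one_re]; linarith) h0
  simp only [leftSum, Fstar_eq_tsum]
  exact hlim

end Limits

/-- The numerator of the rational function whose residues are summed. -/
def residueNum (b c d g : ℂ) (N₁ N₂ n : ℕ) : Polynomial ℂ :=
  (∏ j ∈ Finset.range N₁, (Polynomial.X - Polynomial.C (-g - j))) *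
    (∏ j ∈ Finset.range N₂, (Polynomial.X - Polynomial.C (1 - b + j))) *
    (∏ j ∈ Finset.range n, (Polynomial.X - Polynomial.C (1 - c + j))) *
    (∏ j ∈ Finset.range n, (Polynomial.X - Polynomial.C (1 - d + j)))

lemma residueNum_monic (b c d g : ℂ) (N₁ N₂ n : ℕ) : (residueNum b c d g N₁ N₂ n).Monic :=
  (((Polynomial.monic_prod_X_sub_C _ _).mul (Polynomial.monic_prod_X_sub_C _ _)).mul
    (Polynomial.monic_prod_X_sub_C _ _)).mul (Polynomial.monic_prod_X_sub_C _ _)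

lemma natDegree_residueNum (b c d g : ℂ) (N₁ N₂ n : ℕ) :
    (residueNum b c d g N₁ N₂ n).natDegree = N₁ + N₂ + n + n := by
  have h1 := Polynomial.monic_prod_X_sub_C (fun j : ℕ => -g - (j : ℂ)) (Finset.range N₁)
  have h2 := Polynomial.monic_prod_X_sub_C (fun j : ℕ => 1 - b + (j : ℂ)) (Finset.range N₂)
  have h3 := Polynomial.monic_prod_X_sub_C (fun j : ℕ => 1 - c + (j : ℂ)) (Finset.range n)
  have h4 := Polynomial.monic_prod_X_sub_C (fun j : ℕ => 1 - d + (j : ℂ)) (Finset.range n)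
  rw [residueNum, ((h1.mul h2).mul h3).natDegree_mul h4, (h1.mul h2).natDegree_mul h3,
    h1.natDegree_mul h2]
  simp only [Polynomial.natDegree_finsetProd_X_sub_C_eq_card, Finset.card_range]

lemma eval_residueNum (b c d g : ℂ) (N₁ N₂ n : ℕ) (r : ℂ) :
    (residueNum b c d g N₁ N₂ n).eval r =
      (∏ j ∈ Finset.range N₁, (r - (-g - j))) * (∏ j ∈ Finset.range N₂, (r - (1 - b + j))) *
        (∏ j ∈ Finset.range n, (r - (1 - c + j))) *
        (∏ j ∈ Finset.range n, (r - (1 - d + j))) := by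
  simp [residueNum, Polynomial.eval_prod]

lemma right_sum_eq {a b c d g x y z δ₁ δ₂ : ℂ} (hxa : NotInt (x - a)) (hxb : NotInt (x - b))
    (hxc : NotInt (x - c)) (hxd : NotInt (x - d)) (hxg : NotInt (x - g)) (hxy : NotInt (x - y))
    (hxz : NotInt (x - z)) {N₁ N₂ n : ℕ} (hN₁ : (N₁ : ℂ) = n + δ₁) (hN₂ : (N₂ : ℂ) = n + δ₂) :
    ∑ k ∈ Finset.range n, (residueNum b c d g N₁ N₂ n).eval (1 - x + k) /
      ((∏ j ∈ (Finset.range n).erase k, (1 - x + k - (1 - x + j))) *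
        ((∏ j ∈ Finset.range n, (1 - x + k - (-a - j))) *
          (∏ j ∈ Finset.range n, (1 - x + k - (1 - y + j))) *
          (∏ j ∈ Finset.range n, (1 - x + k - (1 - z + j))))) =
      -(-1) ^ (N₂ + n) * (Sn (x - b) * Sn (x - c) * Sn (x - d) /
        ((Real.pi : ℂ) * Sn (x - y) * Sn (x - z))) *
      rightSum (1 + a - x) (1 + g - x) (x - b) (x - c) (x - d) (x - y) (x - z) δ₁ δ₂ n := by
  rw [rightSum, Finset.mul_sum]
  refine Finset.sum_congr rfl fun k hk => ?_
  have hA : NotInt (1 + a - x) := hxa.neg_add_int 1 (by push_cast; ring)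
  have hG : NotInt (1 + g - x) := hxg.neg_add_int 1 (by push_cast; ring)
  rw [← right_residue hA hG hxb hxc hxd hxy hxz hN₁ hN₂ (by simpa using hk), eval_residueNum]
  congr 1
  · congr 1
    · congr 1
      · congr 1
        · exact Finset.prod_congr rfl fun j _ => by ring
        · exact prod_range_eq_neg_one_pow_mul _ fun j => by ring
      · exact prod_range_eq_neg_one_pow_mul _ fun j => by ring
    · exact prod_range_eq_neg_one_pow_mul _ fun j => by ring
  · congr 1
    · exact Finset.prod_congr rfl fun j _ => by ring
    · congr 1
      · congr 1
        · exact Finset.prod_congr rfl fun j _ => by ring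
        · exact prod_range_eq_neg_one_pow_mul _ fun j => by ring
      · exact prod_range_eq_neg_one_pow_mul _ fun j => by ring

lemma left_sum_eq {a b c d g x y z δ₁ δ₂ : ℂ} (hxa : NotInt (x - a)) (hya : NotInt (y - a))
    (hza : NotInt (z - a)) (hga : NotInt (g - a)) (hab : NotInt (a - b)) (hac : NotInt (a - c))
    (had : NotInt (a - d)) {N₁ N₂ n : ℕ} (hN₁ : (N₁ : ℂ) = n + δ₁) (hN₂ : (N₂ : ℂ) = n + δ₂) :
    ∑ k ∈ Finset.range n, (residueNum b c d g N₁ N₂ n).eval (-a - k) /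
      ((∏ j ∈ (Finset.range n).erase k, (-a - k - (-a - j))) *
        ((∏ j ∈ Finset.range n, (-a - k - (1 - x + j))) *
          (∏ j ∈ Finset.range n, (-a - k - (1 - y + j))) *
          (∏ j ∈ Finset.range n, (-a - k - (1 - z + j))))) =
      (-1) ^ (N₂ + n) * (Sn (g - a) / (Real.pi : ℂ)) *
      leftSum (g - a) (1 + a - b) (1 + a - c) (1 + a - d) (1 + a - x) (1 + a - y) (1 + a - z)
        δ₁ δ₂ n := by
  rw [leftSum, Finset.mul_sum]
  refine Finset.sum_congr rfl fun k hk => ?_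
  rw [← left_residue hga (hab.add_int 1 (by push_cast; ring)) (hac.add_int 1 (by push_cast; ring))
    (had.add_int 1 (by push_cast; ring)) (hxa.neg_add_int 1 (by push_cast; ring))
    (hya.neg_add_int 1 (by push_cast; ring)) (hza.neg_add_int 1 (by push_cast; ring))
    hN₁ hN₂ (by simpa using hk), eval_residueNum]
  congr 1
  · congr 1
    · congr 1
      · congr 1
        · exact Finset.prod_congr rfl fun j _ => by ring
        · exact prod_range_eq_neg_one_pow_mul _ fun j => by ring
      · exact prod_range_eq_neg_one_pow_mul _ fun j => by ring
    · exact prod_range_eq_neg_one_pow_mul _ fun j => by ring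
  · congr 1
    · have hcard : n - 1 = ((Finset.range n).erase k).card := by
        rw [Finset.card_erase_of_mem hk, Finset.card_range]
      rw [hcard, ← Finset.prod_neg]
      exact Finset.prod_congr rfl fun j _ => by ring
    · congr 1
      · congr 1
        · exact prod_range_eq_neg_one_pow_mul _ fun j => by ring
        · exact prod_range_eq_neg_one_pow_mul _ fun j => by ring
      · exact prod_range_eq_neg_one_pow_mul _ fun j => by ring

/-- The pairwise distinctness modulo `ℤ` of the parameters that the four-term relation needs. -/
structure Generic (a b c d g x y z : ℂ) : Prop where
  xy : NotInt (x - y)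
  xz : NotInt (x - z)
  yz : NotInt (y - z)
  xa : NotInt (x - a)
  xb : NotInt (x - b)
  xc : NotInt (x - c)
  xd : NotInt (x - d)
  xg : NotInt (x - g)
  ya : NotInt (y - a)
  yb : NotInt (y - b)
  yc : NotInt (y - c)
  yd : NotInt (y - d)
  yg : NotInt (y - g)
  za : NotInt (z - a)
  zb : NotInt (z - b)
  zc : NotInt (z - c)
  zd : NotInt (z - d)
  zg : NotInt (z - g)
  ga : NotInt (g - a)
  ab : NotInt (a - b)
  ac : NotInt (a - c)
  ad : NotInt (a - d)

lemma NotInt.symm {u v : ℂ} (h : NotInt (u - v)) : NotInt (v - u) :=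
  h.neg_add_int 0 (by push_cast; ring)

lemma finite_four_term {a b c d g x y z δ₁ δ₂ : ℂ} (h : Generic a b c d g x y z) {N₁ N₂ n : ℕ}
    (hN₁ : (N₁ : ℂ) = n + δ₁) (hN₂ : (N₂ : ℂ) = n + δ₂) (hN : N₁ + N₂ + 1 = 2 * n) :
    Sn (g - a) / (Real.pi : ℂ) *
        leftSum (g - a) (1 + a - b) (1 + a - c) (1 + a - d) (1 + a - x) (1 + a - y) (1 + a - z)
          δ₁ δ₂ n
      - Sn (x - b) * Sn (x - c) * Sn (x - d) / ((Real.pi : ℂ) * Sn (x - y) * Sn (x - z)) *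
        rightSum (1 + a - x) (1 + g - x) (x - b) (x - c) (x - d) (x - y) (x - z) δ₁ δ₂ n
      - Sn (y - b) * Sn (y - c) * Sn (y - d) / ((Real.pi : ℂ) * Sn (y - x) * Sn (y - z)) *
        rightSum (1 + a - y) (1 + g - y) (y - b) (y - c) (y - d) (y - x) (y - z) δ₁ δ₂ n
      - Sn (z - b) * Sn (z - c) * Sn (z - d) / ((Real.pi : ℂ) * Sn (z - x) * Sn (z - y)) *
        rightSum (1 + a - z) (1 + g - z) (z - b) (z - c) (z - d) (z - x) (z - y) δ₁ δ₂ n =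
      (-1) ^ (N₂ + n) := by
  have key := sum_div_prod_sub_eq_one (n := n)
    ![fun k : ℕ => -a - (k : ℂ), fun k : ℕ => 1 - x + (k : ℂ), fun k : ℕ => 1 - y + (k : ℂ),
      fun k : ℕ => 1 - z + (k : ℂ)] ?_ (residueNum_monic b c d g N₁ N₂ n)
    (by rw [natDegree_residueNum]; omega)
  · have e0 : (Finset.univ : Finset (Fin 4)).erase 0 = {1, 2, 3} := by decide
    have e1 : (Finset.univ : Finset (Fin 4)).erase 1 = {0, 2, 3} := by decide
    have e2 : (Finset.univ : Finset (Fin 4)).erase 2 = {0, 1, 3} := by decide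
    have e3 : (Finset.univ : Finset (Fin 4)).erase 3 = {0, 1, 2} := by decide
    have p0 (F : Fin 4 → ℂ) : ∏ i ∈ {1, 2, 3}, F i = F 1 * F 2 * F 3 := by
      simp [mul_assoc]
    have p1 (F : Fin 4 → ℂ) : ∏ i ∈ {0, 2, 3}, F i = F 0 * F 2 * F 3 := by
      simp [mul_assoc]
    have p2 (F : Fin 4 → ℂ) : ∏ i ∈ {0, 1, 3}, F i = F 0 * F 1 * F 3 := by
      simp [mul_assoc]
    have p3 (F : Fin 4 → ℂ) : ∏ i ∈ {0, 1, 2}, F i = F 0 * F 1 * F 2 := by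
      simp [mul_assoc]
    rw [Fin.sum_univ_four, e0, e1, e2, e3] at key
    simp only [p0, p1, p2, p3] at key
    have key' := key
    dsimp only [Matrix.cons_val] at key'
    rw [left_sum_eq h.xa h.ya h.za h.ga h.ab h.ac h.ad hN₁ hN₂,
      right_sum_eq h.xa h.xb h.xc h.xd h.xg h.xy h.xz hN₁ hN₂,
      right_sum_eq h.ya h.yb h.yc h.yd h.yg h.xy.symm h.yz hN₁ hN₂,
      right_sum_eq h.za h.zb h.zc h.zd h.zg h.xz.symm h.yz.symm hN₁ hN₂] at key'
    have hs : ((-1 : ℂ) ^ (N₂ + n)) * (-1) ^ (N₂ + n) = 1 := by rw [← mul_pow]; simp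
    generalize (-1 : ℂ) ^ (N₂ + n) = σ at *
    generalize leftSum _ _ _ _ _ _ _ _ _ _ = L at *
    generalize rightSum (1 + a - x) _ _ _ _ _ _ _ _ _ = R₁ at *
    generalize rightSum (1 + a - y) _ _ _ _ _ _ _ _ _ = R₂ at *
    generalize rightSum (1 + a - z) _ _ _ _ _ _ _ _ _ = R₃ at *
    linear_combination σ * key' - (Sn (g - a) / (Real.pi : ℂ) * L
      - Sn (x - b) * Sn (x - c) * Sn (x - d) / ((Real.pi : ℂ) * Sn (x - y) * Sn (x - z)) * R₁
      - Sn (y - b) * Sn (y - c) * Sn (y - d) / ((Real.pi : ℂ) * Sn (y - x) * Sn (y - z)) * R₂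
      - Sn (z - b) * Sn (z - c) * Sn (z - d) / ((Real.pi : ℂ) * Sn (z - x) * Sn (z - y)) * R₃) * hs
  · have hsame (u v : ℂ) (huv : NotInt (u - v)) (k l : ℕ) : 1 - u + (k : ℂ) ≠ 1 - v + l :=
      fun hkl => huv (k - l) (by push_cast; linear_combination -hkl)
    have hleft (u : ℂ) (hu : NotInt (u - a)) (k l : ℕ) : -a - (k : ℂ) ≠ 1 - u + l :=
      fun hkl => hu (1 + k + l) (by push_cast; linear_combination hkl)
    intro i j k l hij
    fin_cases i <;> fin_cases j <;> simp only at hij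
    · exact ⟨rfl, by simpa using hij⟩
    · exact absurd hij (hleft x h.xa k l)
    · exact absurd hij (hleft y h.ya k l)
    · exact absurd hij (hleft z h.za k l)
    · exact absurd hij.symm (hleft x h.xa l k)
    · exact ⟨rfl, by simpa using hij⟩
    · exact absurd hij (hsame x y h.xy k l)
    · exact absurd hij (hsame x z h.xz k l)
    · exact absurd hij.symm (hleft y h.ya l k)
    · exact absurd hij (hsame y x h.xy.symm k l)
    · exact ⟨rfl, by simpa using hij⟩
    · exact absurd hij (hsame y z h.yz k l)
    · exact absurd hij.symm (hleft z h.za l k)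
    · exact absurd hij (hsame z x h.xz.symm k l)
    · exact absurd hij (hsame z y h.yz.symm k l)
    · exact ⟨rfl, by simpa using hij⟩

open Filter Topology in
/-- The four-term relation between Saalschützian series that underlies the three-term relation. -/
theorem four_term_relation {a b c d g x y z : ℂ} (h : Generic a b c d g x y z)
    (hsaal : x + y + z + g = a + b + c + d + 2) :
    Sn (g - a) * Fstar (1 + a - x) (1 + a - y) (1 + a - z) (1 + a - g)
        (1 + a - b) (1 + a - c) (1 + a - d) =
      Sn (x - b) * Sn (x - c) * Sn (x - d) / (Sn (x - y) * Sn (x - z)) *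
        Fstar (1 + a - x) (1 + b - x) (1 + c - x) (1 + d - x) (1 + y - x) (1 + z - x) (1 + g - x) +
      Sn (y - b) * Sn (y - c) * Sn (y - d) / (Sn (y - x) * Sn (y - z)) *
        Fstar (1 + a - y) (1 + b - y) (1 + c - y) (1 + d - y) (1 + x - y) (1 + z - y) (1 + g - y) +
      Sn (z - b) * Sn (z - c) * Sn (z - d) / (Sn (z - x) * Sn (z - y)) *
        Fstar (1 + a - z) (1 + b - z) (1 + c - z) (1 + d - z) (1 + x - z) (1 + y - z)
          (1 + g - z) := by
  set p : ℤ := ⌊(g - a).re⌋ with hp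
  have hp0 : 0 ≤ (g - a - p).re := by
    rw [sub_re, intCast_re]
    linarith [Int.floor_le (g - a).re]
  have hp1 : (g - a - p).re ≤ 1 := by
    rw [sub_re, intCast_re]
    linarith [Int.lt_floor_add_one (g - a).re]
  have hδ : -(p : ℂ) + ((p : ℂ) - 1) = -1 := by ring
  have hflip (u v : ℂ) : 1 - (u - v) = 1 + v - u := by ring
  have hL := tendsto_leftSum (δ₁ := -(p : ℂ)) (δ₂ := (p : ℂ) - 1) h.ga
    (h.ab.add_int (w := 1 + a - b) 1 (by push_cast; ring))
    (h.ac.add_int (w := 1 + a - c) 1 (by push_cast; ring))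
    (h.ad.add_int (w := 1 + a - d) 1 (by push_cast; ring))
    (h.xa.neg_add_int (w := 1 + a - x) 1 (by push_cast; ring))
    (h.ya.neg_add_int (w := 1 + a - y) 1 (by push_cast; ring))
    (h.za.neg_add_int (w := 1 + a - z) 1 (by push_cast; ring))
    (h.ga.add_int (-p) (by push_cast; ring)) (h.ab.add_int p (by ring)) hδ
    (by linear_combination hsaal) (by rwa [← sub_eq_add_neg]) (by rwa [← sub_eq_add_neg])
  have hR {x y z : ℂ} (xa : NotInt (x - a)) (xb : NotInt (x - b)) (xc : NotInt (x - c))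
      (xd : NotInt (x - d)) (xg : NotInt (x - g)) (xy : NotInt (x - y)) (xz : NotInt (x - z))
      (hs : x + y + z + g = a + b + c + d + 2) :=
    have e : 1 + g - x + -(p : ℂ) - (1 + a - x) = g - a - p := by ring
    tendsto_rightSum (δ₁ := -(p : ℂ)) (δ₂ := (p : ℂ) - 1)
      (xa.neg_add_int (w := 1 + a - x) 1 (by push_cast; ring))
      (xg.neg_add_int (w := 1 + g - x) 1 (by push_cast; ring)) xb xc xd xy xz
      (xg.neg_add_int (1 - p) (by push_cast; ring)) (xb.add_int (p - 1) (by push_cast; ring)) hδ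
      (by linear_combination hs) (by rwa [e]) (by rwa [e])
  have h1 := hR h.xa h.xb h.xc h.xd h.xg h.xy h.xz hsaal
  have h2 := hR h.ya h.yb h.yc h.yd h.yg h.xy.symm h.yz (by linear_combination hsaal)
  have h3 := hR h.za h.zb h.zc h.zd h.zg h.xz.symm h.yz.symm (by linear_combination hsaal)
  simp only [hflip] at hL h1 h2 h3
  have hlim := (((hL.const_mul (Sn (g - a) / (Real.pi : ℂ))).sub (h1.const_mul (Sn (x - b) *
    Sn (x - c) * Sn (x - d) / ((Real.pi : ℂ) * Sn (x - y) * Sn (x - z))))).sub (h2.const_mul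
    (Sn (y - b) * Sn (y - c) * Sn (y - d) / ((Real.pi : ℂ) * Sn (y - x) * Sn (y - z))))).sub
    (h3.const_mul (Sn (z - b) * Sn (z - c) * Sn (z - d) /
      ((Real.pi : ℂ) * Sn (z - x) * Sn (z - y))))
  have hzero : Tendsto (fun n : ℕ => ((-1) ^ (((n : ℤ) + p - 1).toNat + n) : ℂ) / n) atTop
      (𝓝 0) := by
    rw [tendsto_zero_iff_norm_tendsto_zero]
    refine (tendsto_const_div_atTop_nhds_zero_nat (1 : ℝ)).congr fun n => ?_
    simp
  have heq := tendsto_nhds_unique (hlim.congr' ?_) hzero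
  · have hpi : (Real.pi : ℂ) ≠ 0 := by exact_mod_cast Real.pi_ne_zero
    have hxy := h.xy.Sn_ne_zero
    have hxz := h.xz.Sn_ne_zero
    have hyx := h.xy.symm.Sn_ne_zero
    have hyz := h.yz.Sn_ne_zero
    have hzx := h.xz.symm.Sn_ne_zero
    have hzy := h.yz.symm.Sn_ne_zero
    have hd (u v w : ℂ) : u / ((Real.pi : ℂ) * v * w) = (Real.pi : ℂ)⁻¹ * (u / (v * w)) := by
      rw [mul_assoc, ← div_div, div_eq_inv_mul u, mul_div_assoc]
    rw [hd, hd, hd, div_eq_inv_mul (Sn (g - a))] at heq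
    refine mul_left_cancel₀ (inv_ne_zero hpi) ?_
    linear_combination heq
  · filter_upwards [eventually_ge_atTop (p.natAbs + 1)] with n hn
    have hN₁ : ((((n : ℤ) - p).toNat : ℕ) : ℤ) = n - p := Int.toNat_of_nonneg (by omega)
    have hN₂ : ((((n : ℤ) + p - 1).toNat : ℕ) : ℤ) = n + p - 1 := Int.toNat_of_nonneg (by omega)
    have hN₁' : ((((n : ℤ) - p).toNat : ℕ) : ℂ) = n + -(p : ℂ) := by
      rw [← Int.cast_natCast, hN₁]
      push_cast
      ring
    have hN₂' : ((((n : ℤ) + p - 1).toNat : ℕ) : ℂ) = n + ((p : ℂ) - 1) := by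
      rw [← Int.cast_natCast, hN₂]
      push_cast
      ring
    rw [← finite_four_term h hN₁' hN₂' (by omega)]
    ring

lemma Sn_neg (x : ℂ) : Sn (-x) = -Sn x := by
  rw [Sn, mul_neg, Complex.sin_neg, Sn]

lemma Sn_one_sub (x : ℂ) : Sn (1 - x) = Sn x := by
  rw [Sn, mul_sub, mul_one, Complex.sin_pi_sub, Sn]

lemma Sn_eq_exp (x : ℂ) :
    Sn x = ((exp (Real.pi * x * I))⁻¹ - exp (Real.pi * x * I)) * I / 2 := by
  rw [Sn, Complex.sin, ← exp_neg, neg_mul]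

lemma Sn_identity (b c d e f : ℂ) :
    Sn (f - e) * Sn (e + f - b - c - d) * Sn e * Sn f + Sn (e - b) * Sn (e - c) * Sn (e - d) * Sn f -
      Sn (f - b) * Sn (f - c) * Sn (f - d) * Sn e + Sn (f - e) * Sn b * Sn c * Sn d = 0 := by
  simp only [Sn_eq_exp, mul_sub, mul_add, sub_mul, add_mul, exp_sub, exp_add]
  have hb := exp_ne_zero (Real.pi * b * I)
  have hc := exp_ne_zero (Real.pi * c * I)
  have hd := exp_ne_zero (Real.pi * d * I)
  have he := exp_ne_zero (Real.pi * e * I)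
  have hf := exp_ne_zero (Real.pi * f * I)
  generalize exp (Real.pi * b * I) = B at *
  generalize exp (Real.pi * c * I) = C at *
  generalize exp (Real.pi * d * I) = D at *
  generalize exp (Real.pi * e * I) = E at *
  generalize exp (Real.pi * f * I) = F at *
  field_simp
  ring

lemma Gamma_one_sub_eq {x : ℂ} (h : NotInt x) :
    Gamma (1 - x) = (Real.pi : ℂ) / (Sn x * Gamma x) := by
  have := Gamma_mul_Gamma_one_sub x
  rw [mul_comm (Sn x), ← div_div, Sn, div_right_comm, ← this, mul_div_cancel_left₀ _ h.gamma_ne_zero]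

/-- The reflection formula in the form in which it cancels the prefactors of `Kf` and `Lf`. -/
lemma Gamma_sub_eq {x y : ℂ} (h : NotInt (x - y)) :
    Gamma (1 + y - x) = (Real.pi : ℂ) / (Sn (x - y) * Gamma (x - y)) := by
  rw [← Gamma_one_sub_eq h]
  congr 1
  ring

lemma Af_mul_Kf {a b c d e f g : ℂ} (ha : NotInt a) (hea : NotInt (e - a))
    (hfa : NotInt (f - a)) (hga : NotInt (g - a)) :
    Af (1 - a) (e - a) (f - a) (g - a) * Kf a b c d e f g =
      Sn (e - a) * Sn (f - a) * Sn (g - a) /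
          ((Real.pi : ℂ) ^ 4 * (Gamma a * Gamma b * Gamma c * Gamma d)) *
        (Fstar a b c d e f g +
          Fstar a (1 + a - e) (1 + a - f) (1 + a - g) (1 + a - b) (1 + a - c) (1 + a - d)) := by
  have := ha.gamma_ne_zero
  have := hea.gamma_ne_zero
  have := hfa.gamma_ne_zero
  have := hga.gamma_ne_zero
  have := ha.Sn_ne_zero
  have := hea.Sn_ne_zero
  have := hfa.Sn_ne_zero
  have := hga.Sn_ne_zero
  rw [Af, Kf, Gamma_one_sub_eq ha, Gamma_sub_eq hea, Gamma_sub_eq hfa, Gamma_sub_eq hga]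
  field_simp

lemma Af_mul_Lf {a b c d e f g : ℂ} (hea : NotInt (e - a)) (heb : NotInt (e - b))
    (hec : NotInt (e - c)) (hed : NotInt (e - d)) :
    Af (e - a) (e - b) (e - c) (e - d) * Lf a b c d e f g =
      Sn (e - a) * Sn (e - b) * Sn (e - c) * Sn (e - d) /
          ((Real.pi : ℂ) ^ 4 * Sn e * (Gamma a * Gamma b * Gamma c * Gamma d)) *
        (Fstar a b c d e f g -
          Fstar (1 + a - e) (1 + b - e) (1 + c - e) (1 + d - e) (2 - e) (1 + f - e)
            (1 + g - e)) := by
  have := hea.gamma_ne_zero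
  have := heb.gamma_ne_zero
  have := hec.gamma_ne_zero
  have := hed.gamma_ne_zero
  have := hea.Sn_ne_zero
  have := heb.Sn_ne_zero
  have := hec.Sn_ne_zero
  have := hed.Sn_ne_zero
  rw [Af, Lf, Gamma_sub_eq hea, Gamma_sub_eq heb, Gamma_sub_eq hec, Gamma_sub_eq hed]
  field_simp

theorem orbit1_KLL_relation (a b c d e f g : ℂ)
    (hsaal : e + f + g = a + b + c + d + 1)
    (hint : ∀ i : Fin 7, ∀ n : ℤ, ![a, b, c, d, e, f, g] i ≠ (n : ℂ))
    (hdiff : ∀ i j : Fin 7, i ≠ j → ∀ n : ℤ,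
      ![a, b, c, d, e, f, g] i - ![a, b, c, d, e, f, g] j ≠ (n : ℂ)) :
    Sn (f - e) * Af (1 - a) (e - a) (f - a) (g - a) * Kf a b c d e f g +
      Sn (f - a) * Af (e - a) (e - b) (e - c) (e - d) * Lf a b c d e f g -
      Sn (e - a) * Af (f - a) (f - b) (f - c) (f - d) * Lf a b c d f e g = 0 := by
  have ha : NotInt a := hint 0
  have hb : NotInt b := hint 1
  have hc : NotInt c := hint 2
  have hd : NotInt d := hint 3
  have he : NotInt e := hint 4
  have hf : NotInt f := hint 5
  have hg : NotInt g := hint 6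
  have one_sub {u : ℂ} (h : NotInt u) : NotInt (1 - u) :=
    h.neg_add_int 1 (by push_cast; ring)
  have hef : NotInt (e - f) := hdiff 4 5 (by decide)
  have hea : NotInt (e - a) := hdiff 4 0 (by decide)
  have heb : NotInt (e - b) := hdiff 4 1 (by decide)
  have hec : NotInt (e - c) := hdiff 4 2 (by decide)
  have hed : NotInt (e - d) := hdiff 4 3 (by decide)
  have hfa : NotInt (f - a) := hdiff 5 0 (by decide)
  have hfb : NotInt (f - b) := hdiff 5 1 (by decide)
  have hfc : NotInt (f - c) := hdiff 5 2 (by decide)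
  have hfd : NotInt (f - d) := hdiff 5 3 (by decide)
  have hga : NotInt (g - a) := hdiff 6 0 (by decide)
  have hgen : Generic a b c d g 1 e f :=
    { xy := one_sub he, xz := one_sub hf, yz := hef
      xa := one_sub ha, xb := one_sub hb, xc := one_sub hc, xd := one_sub hd, xg := one_sub hg
      ya := hea, yb := heb, yc := hec, yd := hed, yg := hdiff 4 6 (by decide)
      za := hfa, zb := hfb, zc := hfc, zd := hfd, zg := hdiff 5 6 (by decide)
      ga := hga, ab := hdiff 0 1 (by decide), ac := hdiff 0 2 (by decide)
      ad := hdiff 0 3 (by decide) }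
  have key := four_term_relation hgen (by linear_combination hsaal)
  have hSga : Sn (g - a) = Sn (e + f - b - c - d) := by
    rw [← Sn_one_sub]
    congr 1
    linear_combination -hsaal
  have hSef : Sn (e - f) = -Sn (f - e) := by rw [← Sn_neg, neg_sub]
  have hSe1 : Sn (e - 1) = -Sn e := by rw [← Sn_one_sub e, ← Sn_neg, neg_sub]
  have hSf1 : Sn (f - 1) = -Sn f := by rw [← Sn_one_sub f, ← Sn_neg, neg_sub]
  have hSe := he.Sn_ne_zero
  have hSf := hf.Sn_ne_zero
  have hSfe := hef.symm.Sn_ne_zero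
  have hΓ : Gamma a * Gamma b * Gamma c * Gamma d ≠ 0 :=
    mul_ne_zero (mul_ne_zero (mul_ne_zero ha.gamma_ne_zero hb.gamma_ne_zero) hc.gamma_ne_zero)
      hd.gamma_ne_zero
  have hπ : (Real.pi : ℂ) ≠ 0 := ofReal_ne_zero.2 Real.pi_ne_zero
  simp only [add_sub_cancel_left, one_add_one_eq_two, Sn_one_sub, hSef, hSe1, hSf1] at key
  rw [mul_assoc, mul_assoc, mul_assoc, Af_mul_Kf ha hea hfa hga, Af_mul_Lf hea heb hec hed,
    Af_mul_Lf hfa hfb hfc hfd]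
  have hswap : Fstar a b c d f e g = Fstar a b c d e f g := by
    simp only [Fstar, mul_assoc, mul_left_comm (Gamma (_ + f)) (Gamma (_ + e))]
  rw [hswap]
  have hid := Sn_identity b c d e f
  rw [← hSga] at hid
  generalize Fstar a b c d e f g = F₀ at *
  generalize Fstar a _ _ _ _ _ _ = F₁ at *
  generalize Fstar (1 + a - e) _ _ _ _ _ _ = F₂ at *
  generalize Fstar (1 + a - f) _ _ _ _ _ _ = F₃ at *
  generalize Gamma a * Gamma b * Gamma c * Gamma d = P at *
  field_simp at key ⊢
  linear_combination (Sn (e - a) * Sn (f - a)) * key + (Sn (e - a) * Sn (f - a)) * F₀ * hid
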